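/- (Polynomial version of the first part of Saito's criterion.) Let A : Matrix (Fin n) (Fin n) R be a matrix over R = MvPolynomial (Fin n) ℂ with entries a_{ik} = A i k, and let δ_i = Σ_k a_{ik} ∂_k be the associated derivations. Suppose that for all i, j the commutator ⁅δ_i, δ_j⁆ lies in the R-span of δ_1, …, δ_n, i.e., there exists α : Fin n → R with ⁅δ_i, δ_j⁆ = Σ_k α_k δ_k. Then for every i, δ_i(det A) belongs to the principal ideal generated by det A; in other words, each δ_i is a logarithmic derivation for the hypersurface det A = 0. -/

import Mathlib

open MvPolynomial Matrix

/-- The vector field `δ_i = Σ_k a_{ik} ∂_k` associated to the `i`-th row of `A`. -/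
noncomputable def rowDerivation {n : ℕ}
    (A : Matrix (Fin n) (Fin n) (MvPolynomial (Fin n) ℂ)) (i : Fin n) :
    Derivation ℂ (MvPolynomial (Fin n) ℂ) (MvPolynomial (Fin n) ℂ) :=
  ∑ k : Fin n, A i k • pderiv k

theorem Derivation.map_finset_prod {R S ι : Type*} [CommSemiring R] [CommSemiring S] [Algebra R S]
    [DecidableEq ι] (D : Derivation R S S) (s : Finset ι) (f : ι → S) :
    D (∏ i ∈ s, f i) = ∑ i ∈ s, ∏ j ∈ s, Function.update f i (D (f i)) j := by
  induction s using Finset.induction_on with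
  | empty => simp
  | insert a s ha ih =>
    have hprod : ∏ j ∈ s, Function.update f a (D (f a)) j = ∏ j ∈ s, f j :=
      Finset.prod_congr rfl fun j hj =>
        Function.update_of_ne (ne_of_mem_of_not_mem hj ha) _ _
    have hsum : ∑ i ∈ s, Function.update f i (D (f i)) a *
        ∏ j ∈ s, Function.update f i (D (f i)) j =
        ∑ i ∈ s, f a * ∏ j ∈ s, Function.update f i (D (f i)) j :=
      Finset.sum_congr rfl fun i hi => by
        rw [Function.update_of_ne (ne_of_mem_of_not_mem hi ha).symm]
    rw [Finset.prod_insert ha, D.leibniz, ih, Finset.sum_insert ha]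
    simp only [Finset.prod_insert ha, hsum, hprod, Function.update_self, smul_eq_mul,
      Finset.mul_sum]
    ring

/-- **Jacobi's formula** for the derivation of a determinant. -/
theorem Derivation.map_det {R S m : Type*} [CommRing R] [CommRing S] [Algebra R S]
    [Fintype m] [DecidableEq m] (D : Derivation R S S) (A : Matrix m m S) :
    D A.det = (A.adjugate * A.map D).trace := by
  have key : D A.det = ∑ i, (A.updateCol i fun k => D (A k i)).det := by
    simp only [Matrix.det_apply, map_sum, Units.smul_def, map_zsmul, D.map_finset_prod,
      Finset.smul_sum]
    rw [Finset.sum_comm]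
    refine Finset.sum_congr rfl fun i _ => Finset.sum_congr rfl fun σ _ => ?_
    congr 1
    refine Finset.prod_congr rfl fun j _ => ?_
    by_cases h : j = i
    · subst h; simp
    · simp [h]
  rw [key]
  refine Finset.sum_congr rfl fun i _ => ?_
  rw [← Matrix.cramer_apply, Matrix.cramer_eq_adjugate_mulVec]
  rfl

theorem rowDerivation_apply {n : ℕ} (A : Matrix (Fin n) (Fin n) (MvPolynomial (Fin n) ℂ))
    (i : Fin n) (p : MvPolynomial (Fin n) ℂ) :
    rowDerivation A i p = ∑ k, A i k * pderiv k p := by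
  simp only [rowDerivation, ← Derivation.coeFnAddMonoidHom_apply, map_sum, Finset.sum_apply]
  rfl

theorem rowDerivation_X {n : ℕ} (A : Matrix (Fin n) (Fin n) (MvPolynomial (Fin n) ℂ))
    (i k : Fin n) : rowDerivation A i (X k) = A i k := by
  simp [rowDerivation_apply, pderiv_X, Pi.single_apply]

/-- Polynomial version of the first part of Saito's criterion: if the commutators
of the `δ_i` lie in their span, then each `δ_i` is logarithmic for `det A = 0`. -/
theorem saito_logarithmic {n : ℕ}
    (A : Matrix (Fin n) (Fin n) (MvPolynomial (Fin n) ℂ))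
    (hα : ∀ i j : Fin n, ∃ α : Fin n → MvPolynomial (Fin n) ℂ,
      ⁅rowDerivation A i, rowDerivation A j⁆
        = ∑ k : Fin n, α k • rowDerivation A k) :
    ∀ i : Fin n, rowDerivation A i A.det ∈ Ideal.span {A.det} := by
  intro i
  choose C hC using hα i
  let J : Matrix (Fin n) (Fin n) (MvPolynomial (Fin n) ℂ) := .of fun m k => pderiv m (A i k)
  have hmap : A.map (rowDerivation A i) = Matrix.of C * A + A * J := by
    ext1 j k
    have h := congrArg (fun D => D (X k)) (hC j)
    simp only [Derivation.commutator_apply, rowDerivation_X] at h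
    rw [← Derivation.coeFnAddMonoidHom_apply (∑ l, _), map_sum, Finset.sum_apply] at h
    simp only [Derivation.coeFnAddMonoidHom_apply, Derivation.smul_apply, rowDerivation_X,
      smul_eq_mul, rowDerivation_apply A j] at h
    simpa [Matrix.mul_apply, J] using sub_eq_iff_eq_add.mp h
  rw [Derivation.map_det, hmap, mul_add, Matrix.trace_add, ← mul_assoc, ← mul_assoc,
    Matrix.trace_mul_comm, ← mul_assoc, Matrix.mul_adjugate, Matrix.adjugate_mul,
    smul_mul_assoc, smul_mul_assoc, Matrix.trace_smul, Matrix.trace_smul, ← smul_add]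
  exact Ideal.mem_span_singleton.mpr (dvd_mul_right _ _)
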